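/- Let q > 2 be a prime power and let a ∈ 𝔽_q be nonzero. Then, as permutations of 𝔽_q (equivalently of ℙ¹(𝔽_q) fixing ∞), the transposition (0,a) satisfies Carlitz's identity: (0,a) = λ ∘ ρ ∘ τ_a ∘ ρ ∘ σ' ∘ ρ ∘ τ_a, where ρ is the permutation a ↦ a^{q−2}, τ_a is x ↦ x − a, σ' is x ↦ x + a⁻¹, and λ is x ↦ −a²x. -/

import Mathlib

/-- In a finite field with more than two elements, `x ↦ x ^ (q - 2)` is inversion, also at `0`. -/
lemma pow_card_sub_two_eq_inv {F : Type*} [Field F] [Fintype F]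
    (hq : 2 < Fintype.card F) (x : F) : x ^ (Fintype.card F - 2) = x⁻¹ := by
  rcases eq_or_ne x 0 with rfl | hx
  · rw [inv_zero, zero_pow (by omega)]
  · apply eq_inv_of_mul_eq_one_left
    rw [← pow_succ, show Fintype.card F - 2 + 1 = Fintype.card F - 1 by omega,
      FiniteField.pow_card_sub_one_eq_one x hx]

/-- Carlitz's identity: for nonzero a ∈ 𝔽_q, as permutations of 𝔽_q,
(0,a) = λ ∘ ρ ∘ τ_a ∘ ρ ∘ σ' ∘ ρ ∘ τ_a, where ρ : x ↦ x^{q−2}, τ_a : x ↦ x − a,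
σ' : x ↦ x + a⁻¹, and λ : x ↦ −a²x. -/
theorem carlitz_identity
    {F : Type*} [Field F] [Fintype F] [DecidableEq F]
    (hq : 2 < Fintype.card F)
    (a : F) (ha : a ≠ 0)
    (ρ : Equiv.Perm F) (hρ : ∀ x : F, ρ x = x ^ (Fintype.card F - 2))
    (lam : Equiv.Perm F) (hlam : ∀ x : F, lam x = -a ^ 2 * x) :
    Equiv.swap (0 : F) a
      = lam * ρ * Equiv.subRight a * ρ * Equiv.addRight a⁻¹ * ρ * Equiv.subRight a := by
  ext x
  simp only [Equiv.Perm.mul_apply, Equiv.subRight_apply, Equiv.coe_addRight, hρ, hlam,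
    pow_card_sub_two_eq_inv hq]
  rcases eq_or_ne x 0 with rfl | hx
  · simp only [Equiv.swap_apply_left, zero_sub, inv_neg, neg_add_cancel, inv_zero]
    field_simp
  rcases eq_or_ne x a with rfl | hxa
  · simp
  have hsub : x - a ≠ 0 := sub_ne_zero.mpr hxa
  have hsum : (x - a)⁻¹ + a⁻¹ = x / (a * (x - a)) := by
    field_simp
    ring
  have hdiff : a * (x - a) / x - a = -a ^ 2 / x := by
    field_simp
    ring
  rw [Equiv.swap_apply_of_ne_of_ne hx hxa, hsum, inv_div, hdiff, inv_div]
  field_simp
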